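/- arXiv:1909.00177 — 6 statements merged into one kernel-verified Lean document; each statement's English description precedes it below -/
import Mathlib

section
/- Let M be a weight sequence satisfying the moderate growth condition. If a function f : [−1,1] → ℂ satisfies property (P_M) — i.e. there exist positive constants K, c₁, c₂, ε₀ and a family (f_ε)_{0<ε≤ε₀} of continuous functions on ℂ such that for every ε ∈ (0,ε₀], f_ε is holomorphic in Ω_ε, |f_ε| ≤ K in Ω_ε, and |f − f_ε| ≤ c₁ h_M(c₂ ε) on [−1,1] — then for every real number b with 0 < b < 1, the restriction of f to [−b,b] is smooth and belongs to C_M([−b,b]). -/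
open Set Filter MeasureTheory Topology

/-- A weight sequence: positive, nondecreasing, `M 0 = 1`, logarithmically convex
(the sequence of ratios `M (j+1) / M j` is nondecreasing), and `M j ^ (1/j) → ∞`. -/
def IsWeightSeq (M : ℕ → ℝ) : Prop :=
  (∀ j, 0 < M j) ∧ Monotone M ∧ M 0 = 1 ∧
  (∀ j, M (j + 1) / M j ≤ M (j + 2) / M (j + 1)) ∧
  Tendsto (fun j : ℕ => (M j) ^ (1 / (j : ℝ))) atTop atTop

/-- The moderate growth condition. -/
def ModerateGrowth (M : ℕ → ℝ) : Prop :=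
  ∃ A > 0, ∀ j k : ℕ, M (j + k) ≤ A ^ (j + k) * (M j * M k)

/-- The strong non-quasianalyticity condition. -/
def StrongNQA (M : ℕ → ℝ) : Prop :=
  ∃ A > 0, ∀ k : ℕ, ∑' j : ℕ, M (k + j) / (((k + j : ℕ) + 1) * M ((k + j) + 1))
      ≤ A * (M k / M (k + 1))

/-- The function `h_M` associated with a weight sequence. -/
noncomputable def hFun (M : ℕ → ℝ) (t : ℝ) : ℝ :=
  if t = 0 then 0 else ⨅ j : ℕ, t ^ j * M j

/-- The open ellipse `Ω_ε = φ_ε(S)`, `φ_ε(z) = sin (ε z)`, `S = {|Im z| < 1}`. -/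
noncomputable def OmegaE (ε : ℝ) : Set ℂ :=
  (fun z => Complex.sin (ε * z)) '' {z : ℂ | |z.im| < 1}

/-- Property `(P_M)`: approximation by bounded holomorphic functions on the
ellipses `Ω_ε` with rate `h_M(c₂ ε)`. -/
def PropPM (M : ℕ → ℝ) (f : ℝ → ℂ) : Prop :=
  ∃ K > 0, ∃ c₁ > 0, ∃ c₂ > 0, ∃ ε₀ > 0, ∃ F : ℝ → ℂ → ℂ,
    ∀ ε : ℝ, 0 < ε → ε ≤ ε₀ →
      Continuous (F ε) ∧
      DifferentiableOn ℂ (F ε) (OmegaE ε) ∧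
      (∀ z ∈ OmegaE ε, ‖F ε z‖ ≤ K) ∧
      (∀ x ∈ Icc (-1 : ℝ) 1, ‖f x - F ε (x : ℂ)‖ ≤ c₁ * hFun M (c₂ * ε))

/-- `f` is smooth on `[-b,b]` and belongs to `C_M([-b,b])`. -/
def MemCMIccB (M : ℕ → ℝ) (f : ℝ → ℂ) (b : ℝ) : Prop :=
  ContDiffOn ℝ (⊤ : ℕ∞) f (Icc (-b) b) ∧
  ∃ σ > 0, ∃ C : ℝ, ∀ j : ℕ, ∀ x ∈ Icc (-b) b,
    ‖iteratedDerivWithin j f (Icc (-b) b) x‖ ≤ C * σ ^ j * (j.factorial : ℝ) * M j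

open Metric

theorem rpow_mul_rpow_sq_le {m K t : ℝ} (hm : 0 ≤ m) (hK : 0 < K) (hmK : m ≤ K)
    (ht : t ≤ 1 / 2) : (m ^ (1 - t) * K ^ t) ^ 2 ≤ K * m := by
  have h1 : m ^ (1 - t) = m ^ (1 / 2 : ℝ) * m ^ (1 / 2 - t) := by
    rw [← Real.rpow_add_of_nonneg hm (by norm_num) (by linarith)]; ring_nf
  have h2 : m ^ (1 / 2 - t) ≤ K ^ (1 / 2 - t) := Real.rpow_le_rpow hm hmK (by linarith)
  have h3 : K ^ (1 / 2 - t) * K ^ t = K ^ (1 / 2 : ℝ) := by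
    rw [← Real.rpow_add hK]; ring_nf
  have h4 : m ^ (1 - t) * K ^ t ≤ √m * √K := by
    rw [h1, Real.sqrt_eq_rpow, Real.sqrt_eq_rpow, ← h3, mul_assoc]
    gcongr
  calc (m ^ (1 - t) * K ^ t) ^ 2 ≤ (√m * √K) ^ 2 := by gcongr
    _ = K * m := by rw [mul_pow, Real.sq_sqrt hm, Real.sq_sqrt hK.le, mul_comm]

/-- Hadamard's three lines theorem on one half of the strip `|Im z| < 1`, up to a rotation
by `c`, which is `I` or `-I`. -/
theorem norm_sq_le_of_rotated_strip {g : ℂ → ℂ} {K m : ℝ} (hK : 0 < K) (hmK : m ≤ K) (c : ℂ)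
    (hc : ∀ z : ℂ, |(c * z).im| = |z.re|) (hg : Continuous g)
    (hd : DifferentiableOn ℂ g {z : ℂ | |z.im| < 1})
    (hb : ∀ z : ℂ, |z.im| < 1 → ‖g z‖ ≤ K) (hr : ∀ z : ℂ, z.im = 0 → ‖g z‖ ≤ m)
    {z : ℂ} (hz0 : 0 ≤ z.re) (hz : z.re ≤ 1 / 4) : ‖g (c * z)‖ ^ 2 ≤ K * m := by
  have hm : 0 ≤ m := (norm_nonneg _).trans (hr 0 rfl)
  have key := Complex.HadamardThreeLines.norm_le_interp_of_mem_verticalClosedStrip'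
    (f := fun z => g (c * z)) (z := z) (a := m) (b := K) (l := 0) (u := 1 / 2) (by norm_num)
    ⟨hz0, by linarith⟩ ?_ ?_ ?_ ?_
  · refine (pow_le_pow_left₀ (norm_nonneg _) key 2).trans
      (rpow_mul_rpow_sq_le hm hK hmK ?_)
    rw [div_le_iff₀] <;> linarith
  · refine ⟨hd.comp (by fun_prop) ?_, by fun_prop⟩
    rintro w ⟨h1, h2⟩
    simp only [mem_ofPred_eq, hc]
    rw [abs_of_pos h1]; linarith
  · refine ⟨K, ?_⟩
    rintro _ ⟨w, ⟨h1, h2⟩, rfl⟩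
    apply hb
    rw [hc, abs_of_nonneg h1]; linarith
  · intro w hw
    apply hr
    have := hc w
    rw [show w.re = 0 from hw] at this
    simpa using this
  · intro w hw
    apply hb
    rw [hc, show w.re = 1 / 2 from hw]
    norm_num

theorem norm_sq_le_of_strip {g : ℂ → ℂ} {K m : ℝ} (hK : 0 < K) (hg : Continuous g)
    (hd : DifferentiableOn ℂ g {z : ℂ | |z.im| < 1})
    (hb : ∀ z : ℂ, |z.im| < 1 → ‖g z‖ ≤ K) (hr : ∀ z : ℂ, z.im = 0 → ‖g z‖ ≤ m)
    {z : ℂ} (hz : |z.im| ≤ 1 / 4) : ‖g z‖ ^ 2 ≤ K * m := by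
  obtain hmK | hmK := le_total m K
  · rw [abs_le] at hz
    obtain h | h := le_total 0 z.im
    · have := norm_sq_le_of_rotated_strip hK hmK Complex.I (by simp) hg hd hb hr
        (z := -Complex.I * z) (by simpa using h) (by simpa using hz.2)
      simpa [← mul_assoc] using this
    · have := norm_sq_le_of_rotated_strip hK hmK (-Complex.I) (by simp) hg hd hb hr
        (z := Complex.I * z) (by simpa using h) (by simp; linarith [hz.1])
      simpa [← mul_assoc] using this
  · calc ‖g z‖ ^ 2 ≤ K ^ 2 := by gcongr; exact hb z (by linarith)
      _ ≤ K * m := by nlinarith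

theorem sin_mem_OmegaE {ε : ℝ} (hε : 0 < ε) {u : ℂ} (hu : |u.im| < ε) :
    Complex.sin u ∈ OmegaE ε := by
  refine ⟨u / ε, ?_, ?_⟩
  · simp only [mem_ofPred_eq, Complex.div_ofReal_im, abs_div, abs_of_pos hε]
    rwa [div_lt_one hε]
  · have : (ε : ℂ) ≠ 0 := by exact_mod_cast hε.ne'
    simp only
    rw [mul_div_cancel₀ _ this]

theorem OmegaE_subset {ε ε' : ℝ} (hε : 0 < ε) (h : ε ≤ ε') : OmegaE ε ⊆ OmegaE ε' := by
  rintro _ ⟨z, hz, rfl⟩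
  apply sin_mem_OmegaE (hε.trans_le h)
  simp only [mem_ofPred_eq] at hz
  simp only [Complex.im_ofReal_mul, abs_mul, abs_of_pos hε]
  nlinarith

/-- A two-constants estimate: a bounded holomorphic function on `OmegaE ε` which is small on
`[-1, 1]` is small on a smaller ellipse. -/
theorem norm_sin_sq_le {G : ℂ → ℂ} {K m ε : ℝ} (hK : 0 < K) (hε : 0 < ε) (hG : Continuous G)
    (hd : DifferentiableOn ℂ G (OmegaE ε)) (hb : ∀ z ∈ OmegaE ε, ‖G z‖ ≤ K)
    (hr : ∀ x ∈ Icc (-1 : ℝ) 1, ‖G x‖ ≤ m) {u : ℂ} (hu : |u.im| ≤ ε / 4) :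
    ‖G (Complex.sin u)‖ ^ 2 ≤ K * m := by
  have hε' : (ε : ℂ) ≠ 0 := by exact_mod_cast hε.ne'
  have := norm_sq_le_of_strip (g := fun z => G (Complex.sin (ε * z))) (z := u / ε) (m := m) hK
    (by fun_prop) (hd.comp (by fun_prop) (fun z hz => ⟨z, hz, rfl⟩))
    (fun z hz => hb _ ⟨z, hz, rfl⟩) ?_ ?_
  · simpa only [mul_div_cancel₀ _ hε'] using this
  · intro z hz
    have h1 : Complex.sin (ε * z) = (Real.sin (ε * z.re) : ℝ) := by
      rw [Complex.ofReal_sin]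
      congr 1
      apply Complex.ext <;> simp [hz]
    rw [h1]
    exact hr _ ⟨Real.neg_one_le_sin _, Real.sin_le_one _⟩
  · simp only [Complex.div_ofReal_im, abs_div, abs_of_pos hε]
    rw [div_le_iff₀ hε]; linarith

/-- Points close to `[-b, b]` are values of `sin` at points close to the real axis. -/
theorem exists_sin_eq_of_near {b : ℝ} (hb0 : 0 < b) (hb : b < 1) :
    ∃ κ > 0, ∀ x : ℝ, |x| ≤ b → ∀ δ ≤ (1 - b) / 2, ∀ w ∈ closedBall (x : ℂ) δ,
      ∃ u : ℂ, Complex.sin u = w ∧ κ * |u.im| ≤ δ := by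
  have hpos : 0 < 1 - ((1 + b) / 2) ^ 2 := by nlinarith
  refine ⟨√(1 - ((1 + b) / 2) ^ 2), Real.sqrt_pos.2 hpos, fun x hx δ hδ w hw => ?_⟩
  obtain ⟨u, rfl⟩ := Complex.sin_surjective w
  refine ⟨u, rfl, ?_⟩
  rw [mem_closedBall, dist_eq_norm] at hw
  have hre := (Complex.abs_re_le_norm _).trans hw
  have him := (Complex.abs_im_le_norm _).trans hw
  have e1 : (Complex.sin u).re = Real.sin u.re * Real.cosh u.im := by
    rw [Complex.sin_eq]
    simp [← Complex.ofReal_sin, ← Complex.ofReal_cosh, ← Complex.ofReal_cos,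
      ← Complex.ofReal_sinh]
  have e2 : (Complex.sin u).im = Real.cos u.re * Real.sinh u.im := by
    rw [Complex.sin_eq]
    simp [← Complex.ofReal_sin, ← Complex.ofReal_cosh, ← Complex.ofReal_cos,
      ← Complex.ofReal_sinh]
  simp only [Complex.sub_re, Complex.sub_im, Complex.ofReal_re, Complex.ofReal_im, sub_zero,
    e1, e2] at hre him
  have h1 : |Real.sin u.re| ≤ (1 + b) / 2 := by
    have h2 : |Real.sin u.re * Real.cosh u.im| ≤ (1 + b) / 2 := by
      have := abs_sub_abs_le_abs_sub (Real.sin u.re * Real.cosh u.im) x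
      linarith
    rw [abs_mul, abs_of_pos (Real.cosh_pos u.im)] at h2
    nlinarith [Real.one_le_cosh u.im, abs_nonneg (Real.sin u.re)]
  have h3 : √(1 - ((1 + b) / 2) ^ 2) ≤ |Real.cos u.re| := by
    apply Real.sqrt_le_iff.2 ⟨abs_nonneg _, ?_⟩
    rw [sq_abs]
    have := Real.sin_sq_add_cos_sq u.re
    have h4 : Real.sin u.re ^ 2 ≤ ((1 + b) / 2) ^ 2 := by
      rw [← sq_abs]; gcongr
    linarith
  have h5 : |u.im| ≤ |Real.sinh u.im| := by
    rw [Real.abs_sinh]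
    exact Real.self_le_sinh_iff.2 (abs_nonneg _)
  calc _ ≤ |Real.cos u.re| * |Real.sinh u.im| := by gcongr
    _ ≤ δ := by rwa [← abs_mul]

theorem hFun_le {M : ℕ → ℝ} (hM : ∀ j, 0 < M j) {t : ℝ} (ht : 0 < t) (j : ℕ) :
    hFun M t ≤ t ^ j * M j := by
  rw [hFun, if_neg ht.ne']
  exact ciInf_le ⟨0, by rintro _ ⟨j, rfl⟩; have := hM j; positivity⟩ j

/-- Term-by-term differentiation of a rapidly converging series of analytic functions. -/
theorem contDiffOn_and_norm_iteratedDerivWithin_le {f : ℝ → ℂ} {b b' : ℝ} (hb0 : 0 < b)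
    (hbb : b < b') {P : ℕ → ℂ → ℂ} {B : ℕ → ℝ}
    (hP : ∀ n, ∀ x ∈ Ioo (-b') b', AnalyticAt ℂ (P n) (x : ℂ))
    (hB : ∀ j n, ∀ x ∈ Ioo (-b') b', ‖iteratedDeriv j (P n) (x : ℂ)‖ ≤ B j * (1 / 2) ^ n)
    (hf : ∀ x ∈ Icc (-b) b, HasSum (fun n => P n x) (f x)) :
    ContDiffOn ℝ (⊤ : ℕ∞) f (Icc (-b) b) ∧ ∀ j, ∀ x ∈ Icc (-b) b,
      ‖iteratedDerivWithin j f (Icc (-b) b) x‖ ≤ B j * 2 := by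
  have hsub : Icc (-b) b ⊆ Ioo (-b') b' := Icc_subset_Ioo (by linarith) hbb
  have hsum (j : ℕ) : HasSum (fun n => B j * (1 / 2 : ℝ) ^ n) (B j * 2) :=
    hasSum_geometric_two.mul_left _
  set g : ℕ → ℝ → ℂ := fun j x => ∑' n, iteratedDeriv j (P n) (x : ℂ) with hg
  have hder (j : ℕ) (x : ℝ) (hx : x ∈ Icc (-b) b) : HasDerivAt (g j) (g (j + 1) x) x := by
    refine hasDerivAt_tsum_of_isPreconnected (g := fun n (y : ℝ) => iteratedDeriv j (P n) (y : ℂ))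
      (g' := fun n (y : ℝ) => iteratedDeriv (j + 1) (P n) (y : ℂ))
      (hsum (j + 1)).summable isOpen_Ioo
      isPreconnected_Ioo (fun n y hy => ?_) (hB (j + 1)) (hsub hx) ?_ (hsub hx)
    · apply HasDerivAt.comp_ofReal
      rw [iteratedDeriv_succ]
      apply DifferentiableAt.hasDerivAt
      rw [iteratedDeriv_eq_iterate]
      exact ((hP n y hy).iterated_deriv j).differentiableAt
    · exact .of_norm_bounded (hsum j).summable fun n => hB j n x (hsub hx)
  have huniq : UniqueDiffOn ℝ (Icc (-b) b) := uniqueDiffOn_Icc (by linarith)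
  have hit (j : ℕ) : ∀ x ∈ Icc (-b) b, iteratedDerivWithin j f (Icc (-b) b) x = g j x := by
    induction j with
    | zero =>
      intro x hx
      simp [hg, (hf x hx).tsum_eq]
    | succ j ih =>
      intro x hx
      rw [iteratedDerivWithin_succ, derivWithin_congr ih (ih x hx)]
      exact (hder j x hx).hasDerivWithinAt.derivWithin (huniq x hx)
  refine ⟨contDiffOn_of_differentiableOn_deriv fun j _ => ?_, fun j x hx => ?_⟩
  · exact DifferentiableOn.congr
      (fun x hx => (hder j x hx).differentiableAt.differentiableWithinAt) (hit j)
  · rw [hit j x hx]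
    exact tsum_of_norm_bounded (hsum j) fun n => hB j n x (hsub hx)

/-- Cauchy estimates on discs contained in the image under `sin` of a horizontal strip. -/
theorem analyticAt_and_norm_iteratedDeriv_le {G : ℂ → ℂ} {x δ θ η L : ℝ} (hη : 0 < η)
    (hθη : θ < η) (hδ : 0 < δ) (hG : Continuous G) (hd : DifferentiableOn ℂ G (OmegaE η))
    (hL : ∀ u : ℂ, |u.im| ≤ θ → ‖G (Complex.sin u)‖ ≤ L)
    (hx : ∀ w ∈ closedBall (x : ℂ) δ, ∃ u : ℂ, Complex.sin u = w ∧ |u.im| ≤ θ) :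
    AnalyticAt ℂ G (x : ℂ) ∧
      ∀ j : ℕ, ‖iteratedDeriv j G (x : ℂ)‖ ≤ j.factorial * L / δ ^ j := by
  have hball : DifferentiableOn ℂ G (ball (x : ℂ) δ) := by
    refine hd.mono fun w hw => ?_
    obtain ⟨u, rfl, hu⟩ := hx w (ball_subset_closedBall hw)
    exact sin_mem_OmegaE hη (hu.trans_lt hθη)
  refine ⟨hball.analyticAt (ball_mem_nhds _ hδ), fun j => ?_⟩
  refine Complex.norm_iteratedDeriv_le_of_forall_mem_sphere_norm_le j hδ
    ⟨hball, hG.continuousOn⟩ fun w hw => ?_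
  obtain ⟨u, rfl, hu⟩ := hx w (sphere_subset_closedBall hw)
  exact hL u hu

/-- Comparison of two approximations `F₁` and `F₂` of `f` at scales `ε / 2` and `ε`. -/
theorem norm_sub_sin_le {M : ℕ → ℝ} (hM : ∀ j, 0 < M j) {A : ℝ} (hA : 0 < A)
    (hMG : ∀ j k : ℕ, M (j + k) ≤ A ^ (j + k) * (M j * M k)) {f : ℝ → ℂ} {F₁ F₂ : ℂ → ℂ}
    {K c₁ c₂ ε : ℝ} (hK : 0 < K) (hc₁ : 0 < c₁) (hc₂ : 0 < c₂) (hε : 0 < ε)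
    (hF₁ : Continuous F₁) (hF₂ : Continuous F₂)
    (hd₁ : DifferentiableOn ℂ F₁ (OmegaE (ε / 2))) (hd₂ : DifferentiableOn ℂ F₂ (OmegaE ε))
    (hb₁ : ∀ z ∈ OmegaE (ε / 2), ‖F₁ z‖ ≤ K) (hb₂ : ∀ z ∈ OmegaE ε, ‖F₂ z‖ ≤ K)
    (h₁ : ∀ x ∈ Icc (-1 : ℝ) 1, ‖f x - F₁ (x : ℂ)‖ ≤ c₁ * hFun M (c₂ * (ε / 2)))
    (h₂ : ∀ x ∈ Icc (-1 : ℝ) 1, ‖f x - F₂ (x : ℂ)‖ ≤ c₁ * hFun M (c₂ * ε))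
    (k : ℕ) {u : ℂ} (hu : |u.im| ≤ ε / 8) :
    ‖(F₁ - F₂) (Complex.sin u)‖ ≤ 2 * √(K * c₁) * ((A * (c₂ * ε)) ^ k * M k) := by
  have hsub : OmegaE (ε / 2) ⊆ OmegaE ε := OmegaE_subset (by positivity) (by linarith)
  have hMk := hM k
  have hM2k := hM (k + k)
  have hlarge : (c₂ * ε) ^ (k + k) * M (k + k) ≤ ((A * (c₂ * ε)) ^ k * M k) ^ 2 := by
    calc _ ≤ (c₂ * ε) ^ (k + k) * (A ^ (k + k) * (M k * M k)) := by gcongr; exact hMG k k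
      _ = _ := by rw [mul_pow A]; ring
  have hsmall : (c₂ * (ε / 2)) ^ (k + k) * M (k + k) ≤ (c₂ * ε) ^ (k + k) * M (k + k) := by
    gcongr; linarith
  have key := norm_sin_sq_le (G := F₁ - F₂) (K := 2 * K)
    (m := 2 * c₁ * ((A * (c₂ * ε)) ^ k * M k) ^ 2) (ε := ε / 2) (by positivity) (by positivity)
    (hF₁.sub hF₂) (hd₁.sub (hd₂.mono hsub)) (fun z hz => ?_) (fun x hx => ?_)
    (u := u) (by linarith)
  · refine (pow_le_pow_iff_left₀ (norm_nonneg _) (by positivity) two_ne_zero).1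
      (key.trans_eq ?_)
    rw [mul_pow (2 * √(K * c₁)), mul_pow 2, Real.sq_sqrt (by positivity)]
    ring
  · have := norm_sub_le (F₁ z) (F₂ z)
    have := hb₁ z hz
    have := hb₂ z (hsub hz)
    simp only [Pi.sub_apply]
    linarith
  · have e : (F₁ - F₂) (x : ℂ) = (f x - F₂ x) - (f x - F₁ x) := by simp
    rw [e]
    calc _ ≤ ‖f x - F₂ x‖ + ‖f x - F₁ x‖ := norm_sub_le _ _
      _ ≤ c₁ * ((A * (c₂ * ε)) ^ k * M k) ^ 2 + c₁ * ((A * (c₂ * ε)) ^ k * M k) ^ 2 := by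
        refine add_le_add ((h₂ x hx).trans ?_) ((h₁ x hx).trans ?_)
        · gcongr
          exact (hFun_le hM (by positivity) (k + k)).trans hlarge
        · gcongr
          exact (hFun_le hM (by positivity) (k + k)).trans (hsmall.trans hlarge)
      _ = _ := by ring

/-- If `M` has moderate growth and `f : [-1,1] → ℂ` satisfies property `(P_M)`, then
`f` is smooth and belongs to `C_M([-b,b])` for every `0 < b < 1`. -/
theorem propPM_memCMIcc
    (M : ℕ → ℝ) (hM : IsWeightSeq M) (hMG : ModerateGrowth M)
    (f : ℝ → ℂ) (hf : PropPM M f) :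
    ∀ b : ℝ, 0 < b → b < 1 → MemCMIccB M f b := by
  intro b hb0 hb1
  obtain ⟨hMpos, hMmono, hM0, -, -⟩ := hM
  obtain ⟨A, hA, hMG⟩ := hMG
  obtain ⟨K, hK, c₁, hc₁, c₂, hc₂, ε₀, hε₀, F, hF⟩ := hf
  obtain ⟨b', hbb', hb'1⟩ := exists_between hb1
  obtain ⟨κ, hκ, hgeo⟩ := exists_sin_eq_of_near (hb0.trans hbb') hb'1
  have hM1 := hMpos 1
  set r : ℝ := min (κ / 8) ((1 - b') / 2 / ε₀) with hr
  have hr0 : 0 < r := lt_min (by positivity) (div_pos (by linarith) hε₀)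
  have hrκ : r ≤ κ / 8 := min_le_left _ _
  have hrε : r * ε₀ ≤ (1 - b') / 2 := by
    rw [← le_div_iff₀ hε₀]; exact min_le_right _ _
  have hdisc (ε : ℝ) (hε : ε ≤ ε₀) (x : ℝ) (hx : x ∈ Ioo (-b') b')
      (w : ℂ) (hw : w ∈ closedBall (x : ℂ) (r * ε)) :
      ∃ u : ℂ, Complex.sin u = w ∧ |u.im| ≤ ε / 8 := by
    obtain ⟨u, hu, h⟩ := hgeo x (abs_lt.2 hx).le (r * ε)
      ((mul_le_mul_of_nonneg_left hε hr0.le).trans hrε) w hw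
    have hrε0 : 0 ≤ r * ε := dist_nonneg.trans hw
    have hε0 : 0 ≤ ε := nonneg_of_mul_nonneg_right hrε0 hr0
    refine ⟨u, hu, le_of_mul_le_mul_left ?_ hκ⟩
    nlinarith
  set e : ℕ → ℝ := fun n => ε₀ * (1 / 2) ^ n with he
  have he0 (n : ℕ) : 0 < e n := by positivity
  have hele (n : ℕ) : e n ≤ ε₀ :=
    mul_le_of_le_one_right hε₀.le (pow_le_one₀ (by norm_num) (by norm_num))
  have hes (n : ℕ) : e (n + 1) = e n / 2 := by simp only [he, pow_succ]; ring
  set P : ℕ → ℂ → ℂ := fun n => n.casesOn (F (e 0)) fun k => F (e (k + 1)) - F (e k) with hP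
  set C₁ : ℝ := 4 * √(K * c₁) * A ^ 2 * c₂ * ε₀ * M 1 with hC₁
  set σ : ℝ := A ^ 2 * c₂ / r + 1 / (r * ε₀) with hσ
  have hσ0 : 0 < σ := by positivity
  have hC₁0 : 0 ≤ C₁ := by positivity
  have hPest (n : ℕ) (x : ℝ) (hx : x ∈ Ioo (-b') b') : AnalyticAt ℂ (P n) (x : ℂ) ∧
      ∀ j : ℕ, ‖iteratedDeriv j (P n) (x : ℂ)‖ ≤
        ((K + C₁) * σ ^ j * j.factorial * M j) * (1 / 2) ^ n := by
    cases n with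
    | zero =>
      obtain ⟨h1, h2, h3, -⟩ := hF (e 0) (he0 0) (hele 0)
      have he00 : e 0 = ε₀ := by simp [he]
      obtain ⟨ha, hn⟩ := analyticAt_and_norm_iteratedDeriv_le (G := P 0) (x := x)
        (he0 0) (show e 0 / 8 < e 0 by linarith [he0 0]) (mul_pos hr0 (he0 0)) h1 h2
        (fun u hu => h3 _ (sin_mem_OmegaE (he0 0) (by linarith [he0 0])))
        (hdisc (e 0) (hele 0) x hx)
      refine ⟨ha, fun j => (hn j).trans ?_⟩
      have hMj : 1 ≤ M j := hM0 ▸ hMmono (Nat.zero_le j)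
      calc _ = K * (1 / (r * ε₀)) ^ j * j.factorial * 1 := by
            rw [he00, div_pow, one_pow]; ring
        _ ≤ (K + C₁) * σ ^ j * j.factorial * M j := by
          gcongr
          · linarith
          · exact le_add_of_nonneg_left (by positivity)
        _ = _ := by simp
    | succ n =>
      obtain ⟨h1, h2, h3, h4⟩ := hF (e n) (he0 n) (hele n)
      obtain ⟨h1', h2', h3', h4'⟩ := hF (e (n + 1)) (he0 _) (hele _)
      have hs : OmegaE (e (n + 1)) ⊆ OmegaE (e n) :=
        OmegaE_subset (he0 _) (by linarith [hes n, he0 n])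
      have hest (k : ℕ) := analyticAt_and_norm_iteratedDeriv_le (G := P (n + 1)) (x := x)
        (he0 (n + 1)) (show e n / 8 < e (n + 1) by linarith [hes n, he0 n])
        (mul_pos hr0 (he0 n)) (h1'.sub h1) (h2'.sub (h2.mono hs))
        (fun u hu => norm_sub_sin_le hMpos hA hMG hK hc₁ hc₂ (he0 n) h1' h1
          (hes n ▸ h2') h2 (hes n ▸ h3') h3 (hes n ▸ h4') h4 k hu)
        (hdisc (e n) (hele n) x hx)
      refine ⟨(hest 0).1, fun j => ((hest (j + 1)).2 j).trans ?_⟩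
      have hMj := hMpos j
      have hen := he0 n
      calc _ ≤ j.factorial * (2 * √(K * c₁) * ((A * (c₂ * e n)) ^ (j + 1) *
              (A ^ (j + 1) * (M j * M 1)))) / (r * e n) ^ j := by
            gcongr
            exact hMG j 1
        _ = 2 * √(K * c₁) * A ^ 2 * c₂ * M 1 * e n * (A ^ 2 * c₂ / r) ^ j *
              j.factorial * M j := by
            simp only [div_pow, mul_pow]
            field_simp
            ring
        _ = C₁ * (A ^ 2 * c₂ / r) ^ j * j.factorial * M j * (1 / 2) ^ (n + 1) := by
            simp only [he, hC₁]
            ring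
        _ ≤ _ := by
            gcongr
            · linarith
            · exact le_add_of_nonneg_right (by positivity)
  have hsum (x : ℝ) (hx : x ∈ Icc (-b) b) : HasSum (fun n => P n x) (f x) := by
    have hx' : x ∈ Ioo (-b') b' := Icc_subset_Ioo (by linarith) hbb' hx
    have hx1 : x ∈ Icc (-1 : ℝ) 1 := Icc_subset_Icc (by linarith) (by linarith) hx
    have hsm : Summable fun n => P n x :=
      .of_norm_bounded (summable_geometric_two.mul_left _) fun n => by
        simpa only [iteratedDeriv_zero] using (hPest n x hx').2 0
    have hpart (n : ℕ) : ∑ i ∈ Finset.range (n + 1), P i x = F (e n) x := by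
      induction n with
      | zero => simp [hP]
      | succ n ih => rw [Finset.sum_range_succ, ih]; simp [hP]
    rw [hsm.hasSum_iff_tendsto_nat, ← tendsto_add_atTop_iff_nat 1]
    simp only [hpart]
    rw [tendsto_iff_norm_sub_tendsto_zero]
    have hlim : Tendsto (fun n => c₁ * (c₂ * e n * M 1)) atTop (𝓝 0) := by
      have h := tendsto_pow_atTop_nhds_zero_of_lt_one (r := (1 / 2 : ℝ)) (by norm_num)
        (by norm_num)
      simpa [he] using (((h.const_mul ε₀).const_mul c₂).mul_const (M 1)).const_mul c₁
    refine squeeze_zero (fun n => norm_nonneg _) (fun n => ?_) hlim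
    rw [norm_sub_rev]
    refine ((hF (e n) (he0 n) (hele n)).2.2.2 x hx1).trans ?_
    gcongr
    simpa using hFun_le hMpos (mul_pos hc₂ (he0 n)) 1
  obtain ⟨hsmooth, hbound⟩ := contDiffOn_and_norm_iteratedDerivWithin_le hb0 hbb'
    (fun n x hx => (hPest n x hx).1) (fun j n x hx => (hPest n x hx).2 j) hsum
  refine ⟨hsmooth, σ, hσ0, (K + C₁) * 2, fun j x hx => (hbound j x hx).trans_eq ?_⟩
  ring
end

section
/- There is an absolute constant C > 0 such that for every real number ε with 0 < ε ≤ 1 there exist a radius η_ε > 0, an integer N_ε ≤ C ε^{−3}, and points z_{1,ε},…,z_{N_ε,ε} ∈ ℂ with: (i) Ω_{ε/2} ⊆ ⋃_{j=1}^{N_ε} D(z_{j,ε}, η_ε); and (ii) the closed disk of center z_{j,ε} and radius 2η_ε is contained in Ω_ε for every j = 1,…,N_ε. -/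
open Set Filter Topology

lemma sin_eq_mk (v : ℂ) :
    Complex.sin v = ⟨Real.sin v.re * Real.cosh v.im, Real.cos v.re * Real.sinh v.im⟩ := by
  rw [Complex.sin_eq, Complex.mk_eq_add_mul_I]
  push_cast
  rfl

/-- The sum of the distances from `sin v` to the foci `±1` depends only on `Im v`. -/
lemma norm_sin_sub_one_add_norm_sin_add_one (v : ℂ) :
    ‖Complex.sin v - 1‖ + ‖Complex.sin v + 1‖ = 2 * Real.cosh v.im := by
  have hre : (Complex.sin v).re = Real.sin v.re * Real.cosh v.im := by rw [sin_eq_mk]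
  have him : (Complex.sin v).im = Real.cos v.re * Real.sinh v.im := by rw [sin_eq_mk]
  have hc := Real.one_le_cosh v.im
  have hs := Real.sin_le_one v.re
  have hs' := Real.neg_one_le_sin v.re
  have h1 := Real.sin_sq_add_cos_sq v.re
  have h2 := Real.cosh_sq v.im
  have hm : ‖Complex.sin v - 1‖ = Real.cosh v.im - Real.sin v.re := by
    rw [← sq_eq_sq₀ (norm_nonneg _) (by linarith), Complex.sq_norm, Complex.normSq_apply]
    simp only [Complex.sub_re, Complex.sub_im, Complex.one_re, Complex.one_im, hre, him]
    linear_combination (Real.cosh v.im ^ 2 - 1) * h1 - Real.cos v.re ^ 2 * h2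
  have hp : ‖Complex.sin v + 1‖ = Real.cosh v.im + Real.sin v.re := by
    rw [← sq_eq_sq₀ (norm_nonneg _) (by linarith), Complex.sq_norm, Complex.normSq_apply]
    simp only [Complex.add_re, Complex.add_im, Complex.one_re, Complex.one_im, hre, him]
    linear_combination (Real.cosh v.im ^ 2 - 1) * h1 - Real.cos v.re ^ 2 * h2
  rw [hm, hp]; ring

/-- The description of `OmegaE ε` as an ellipse with foci `±1`. -/
lemma mem_OmegaE_iff {ε : ℝ} (hε : 0 < ε) (u : ℂ) :
    u ∈ OmegaE ε ↔ ‖u - 1‖ + ‖u + 1‖ < 2 * Real.cosh ε := by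
  constructor
  · rintro ⟨z, hz, rfl⟩
    have hz : |z.im| < 1 := hz
    simp only [norm_sin_sub_one_add_norm_sin_add_one]
    have : Real.cosh ((ε : ℂ) * z).im < Real.cosh ε := by
      rw [Real.cosh_lt_cosh, Complex.im_ofReal_mul, abs_mul, abs_of_pos hε]
      nlinarith
    linarith
  · intro h
    obtain ⟨v, rfl⟩ := Complex.sin_surjective u
    rw [norm_sin_sub_one_add_norm_sin_add_one] at h
    have h' : |v.im| < ε := by
      have : Real.cosh v.im < Real.cosh ε := by linarith
      rwa [Real.cosh_lt_cosh, abs_of_pos hε] at this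
    have hε' : (ε : ℂ) ≠ 0 := by exact_mod_cast hε.ne'
    refine ⟨v / ε, ?_, ?_⟩
    · simp only [mem_ofPred_eq, Complex.div_ofReal_im, abs_div, abs_of_pos hε]
      rwa [div_lt_one hε]
    · simp only [mul_div_cancel₀ _ hε']

lemma cosh_half_add_le_cosh {ε : ℝ} (hε : 0 < ε) :
    Real.cosh (ε / 2) + 3 / 8 * ε ^ 2 ≤ Real.cosh ε := by
  have e1 : Real.cosh ε = Real.cosh (3 * ε / 4 + ε / 4) := by ring_nf
  have e2 : Real.cosh (ε / 2) = Real.cosh (3 * ε / 4 - ε / 4) := by ring_nf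
  rw [e1, e2, Real.cosh_add, Real.cosh_sub]
  have h1 : 3 * ε / 4 ≤ Real.sinh (3 * ε / 4) := Real.self_le_sinh_iff.2 (by positivity)
  have h2 : ε / 4 ≤ Real.sinh (ε / 4) := Real.self_le_sinh_iff.2 (by positivity)
  have := mul_le_mul h1 h2 (by positivity) (by linarith)
  nlinarith

/-- A neighbourhood of `OmegaE (ε / 2)` of width `3 / 8 * ε ^ 2` lies inside `OmegaE ε`. -/
lemma mem_OmegaE_of_dist_le {ε : ℝ} (hε : 0 < ε) {u w : ℂ} (hw : w ∈ OmegaE (ε / 2))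
    (huw : dist u w ≤ 3 / 8 * ε ^ 2) : u ∈ OmegaE ε := by
  rw [mem_OmegaE_iff (by positivity)] at hw ⊢
  rw [dist_eq_norm] at huw
  have h1 : ‖u - 1‖ ≤ ‖u - w‖ + ‖w - 1‖ := norm_sub_le_norm_sub_add_norm_sub u w 1
  have h2 : ‖u + 1‖ ≤ ‖u - w‖ + ‖w + 1‖ := by
    simpa using norm_sub_le_norm_sub_add_norm_sub u w (-1)
  linarith [cosh_half_add_le_cosh hε]

lemma abs_re_le_and_abs_im_le_of_mem_OmegaE {ε : ℝ} (hε : 0 < ε) (hε1 : ε ≤ 1) {w : ℂ}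
    (hw : w ∈ OmegaE (ε / 2)) : |w.re| ≤ 2 ∧ |w.im| ≤ ε := by
  have hexp1 := abs_le.1 (Real.abs_exp_sub_one_le (x := ε / 2) (by rw [abs_of_pos] <;> linarith))
  have hexp2 := abs_le.1 (Real.abs_exp_sub_one_le (x := -(ε / 2))
    (by rw [abs_neg, abs_of_pos] <;> linarith))
  rw [abs_neg] at hexp2
  rw [abs_of_pos (by positivity : 0 < ε / 2)] at hexp1 hexp2
  have hcosh : Real.cosh (ε / 2) ≤ 2 := by rw [Real.cosh_eq]; linarith
  have hsinh : Real.sinh (ε / 2) ≤ ε := by rw [Real.sinh_eq]; linarith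
  obtain ⟨z, hz, rfl⟩ := hw
  have hz : |z.im| < 1 := hz
  set v : ℂ := ((ε / 2 : ℝ) : ℂ) * z with hv
  have hvim : |v.im| ≤ ε / 2 := by
    rw [hv, Complex.im_ofReal_mul, abs_mul, abs_of_pos (by positivity : 0 < ε / 2)]
    nlinarith
  have hre : (Complex.sin v).re = Real.sin v.re * Real.cosh v.im := by rw [sin_eq_mk]
  have him : (Complex.sin v).im = Real.cos v.re * Real.sinh v.im := by rw [sin_eq_mk]
  have hc : Real.cosh v.im ≤ Real.cosh (ε / 2) := by
    rw [Real.cosh_le_cosh, abs_of_pos (by positivity : 0 < ε / 2)]; exact hvim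
  have hs : |Real.sinh v.im| ≤ Real.sinh (ε / 2) := by
    rw [Real.abs_sinh, Real.sinh_le_sinh]; exact hvim
  constructor
  · change |(Complex.sin v).re| ≤ 2
    rw [hre, abs_mul, abs_of_pos (Real.cosh_pos _)]
    nlinarith [Real.abs_sin_le_one v.re, abs_nonneg (Real.sin v.re), Real.cosh_pos v.im]
  · change |(Complex.sin v).im| ≤ ε
    rw [him, abs_mul]
    nlinarith [Real.abs_cos_le_one v.re, abs_nonneg (Real.cos v.re), abs_nonneg (Real.sinh v.im)]

/-- There are at most `2 * a + 2` integers of the form `⌊t⌋` with `|t| ≤ a`. -/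
lemma card_Icc_floor_le {a : ℝ} (ha : 0 ≤ a) :
    ((Finset.Icc ⌊-a⌋ ⌊a⌋).card : ℝ) ≤ 2 * a + 2 := by
  have h1 := Int.floor_le a
  have h2 := Int.lt_floor_add_one (-a)
  have h0 : ⌊-a⌋ ≤ ⌊a⌋ := Int.floor_mono (by linarith)
  have h3 : ((Finset.Icc ⌊-a⌋ ⌊a⌋).card : ℤ) = ⌊a⌋ + 1 - ⌊-a⌋ := by
    rw [Int.card_Icc, Int.toNat_of_nonneg (by linarith)]
  have h4 : ((Finset.Icc ⌊-a⌋ ⌊a⌋).card : ℝ) = ⌊a⌋ + 1 - ⌊-a⌋ := by exact_mod_cast h3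
  linarith

lemma floor_div_mem_Icc {x a h : ℝ} (hh : 0 < h) (hx : |x| ≤ a) :
    ⌊x / h⌋ ∈ Finset.Icc ⌊-(a / h)⌋ ⌊a / h⌋ := by
  obtain ⟨h1, h2⟩ := abs_le.1 hx
  rw [Finset.mem_Icc, ← neg_div]
  exact ⟨Int.floor_mono (by gcongr), Int.floor_mono (by gcongr)⟩

lemma abs_sub_floor_div_mul_lt {h : ℝ} (hh : 0 < h) (x : ℝ) : |x - ⌊x / h⌋ * h| < h := by
  have h1 := (le_div_iff₀ hh).1 (Int.floor_le (x / h))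
  have h2 := (div_lt_iff₀ hh).1 (Int.lt_floor_add_one (x / h))
  rw [abs_lt]
  constructor <;> linarith

/-- Covering lemma: there is an absolute constant `C > 0` such that for every
`0 < ε ≤ 1` one can cover `Ω_{ε/2}` by `N_ε ≤ C ε⁻³` open disks of a common radius
`η_ε > 0` whose concentric closed disks of double radius are contained in `Ω_ε`. -/
theorem omegaE_covering :
    ∃ C > 0, ∀ ε : ℝ, 0 < ε → ε ≤ 1 →
      ∃ η > 0, ∃ N : ℕ, (N : ℝ) ≤ C * ε⁻¹ ^ (3 : ℕ) ∧
        ∃ z : Fin N → ℂ,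
          (OmegaE (ε / 2) ⊆ ⋃ j : Fin N, Metric.ball (z j) η) ∧
          (∀ j : Fin N, Metric.closedBall (z j) (2 * η) ⊆ OmegaE ε) := by
  classical
  refine ⟨2244, by norm_num, fun ε hε hε1 => ⟨ε ^ 2 / 8, by positivity, ?_⟩⟩
  set h : ℝ := ε ^ 2 / 16 with hh
  have hpos : 0 < h := by positivity
  let g : ℤ × ℤ → ℂ := fun p => ⟨p.1 * h, p.2 * h⟩
  let S : Finset (ℤ × ℤ) :=
    Finset.Icc ⌊-(2 / h)⌋ ⌊2 / h⌋ ×ˢ Finset.Icc ⌊-(ε / h)⌋ ⌊ε / h⌋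
  let T := S.filter fun p => ∃ w ∈ OmegaE (ε / 2), dist w (g p) < ε ^ 2 / 8
  refine ⟨T.card, ?_, fun j => g (T.equivFin.symm j), ?_, ?_⟩
  · have hT : (T.card : ℝ) ≤ S.card := by exact_mod_cast Finset.card_filter_le _ _
    have hS : (S.card : ℝ) ≤ (2 * (2 / h) + 2) * (2 * (ε / h) + 2) := by
      rw [Finset.card_product, Nat.cast_mul]
      exact mul_le_mul (card_Icc_floor_le (by positivity)) (card_Icc_floor_le (by positivity))
        (by positivity) (by positivity)
    have hi : 1 ≤ ε⁻¹ := (one_le_inv₀ hε).2 hε1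
    have e1 : 2 / h = 32 * ε⁻¹ ^ 2 := by rw [hh]; field_simp; norm_num
    have e2 : ε / h = 16 * ε⁻¹ := by rw [hh]; field_simp
    rw [e1, e2] at hS
    calc (T.card : ℝ) ≤ (2 * (32 * ε⁻¹ ^ 2) + 2) * (2 * (16 * ε⁻¹) + 2) := hT.trans hS
      _ ≤ (66 * ε⁻¹ ^ 2) * (34 * ε⁻¹) := by
        gcongr
        · nlinarith
        · linarith
      _ = 2244 * ε⁻¹ ^ 3 := by ring
  · intro w hw
    obtain ⟨hre, him⟩ := abs_re_le_and_abs_im_le_of_mem_OmegaE hε hε1 hw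
    have hd : dist w (g (⌊w.re / h⌋, ⌊w.im / h⌋)) < ε ^ 2 / 8 := by
      rw [dist_eq_norm]
      refine (Complex.norm_le_abs_re_add_abs_im _).trans_lt ?_
      have h1 := abs_sub_floor_div_mul_lt hpos w.re
      have h2 := abs_sub_floor_div_mul_lt hpos w.im
      simp only [g, Complex.sub_re, Complex.sub_im]
      linarith
    have hmem : (⌊w.re / h⌋, ⌊w.im / h⌋) ∈ T :=
      Finset.mem_filter.2 ⟨Finset.mem_product.2
        ⟨floor_div_mem_Icc hpos hre, floor_div_mem_Icc hpos him⟩, w, hw, hd⟩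
    refine mem_iUnion.2 ⟨T.equivFin ⟨_, hmem⟩, ?_⟩
    simpa using hd
  · intro j u hu
    obtain ⟨w, hw, hd⟩ := (Finset.mem_filter.1 (T.equivFin.symm j).2).2
    refine mem_OmegaE_of_dist_le hε hw ?_
    have := dist_triangle_right u w (g (T.equivFin.symm j))
    rw [Metric.mem_closedBall] at hu
    linarith
end

section
/- For every real number ε with 0 < ε ≤ 1, any closed disk in ℂ of radius ε²/8 that intersects Ω_{ε/2} is contained in Ω_ε. -/
open Set Filter Topology

theorem Complex.sin_re_eq (z : ℂ) : (sin z).re = Real.sin z.re * Real.cosh z.im := by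
  rw [Complex.sin_eq]
  simp only [← ofReal_sin, ← ofReal_cos, ← ofReal_sinh, ← ofReal_cosh]
  simp [-ofReal_sin, -ofReal_cos, -ofReal_sinh, -ofReal_cosh]

theorem Complex.sin_im_eq (z : ℂ) : (sin z).im = Real.cos z.re * Real.sinh z.im := by
  rw [Complex.sin_eq]
  simp only [← ofReal_sin, ← ofReal_cos, ← ofReal_sinh, ← ofReal_cosh]
  simp [-ofReal_sin, -ofReal_cos, -ofReal_sinh, -ofReal_cosh]

theorem Complex.norm_sin_sub_one (z : ℂ) :
    ‖sin z - 1‖ = Real.cosh z.im - Real.sin z.re := by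
  have h0 : 0 ≤ Real.cosh z.im - Real.sin z.re := by
    linarith [Real.one_le_cosh z.im, Real.sin_le_one z.re]
  rw [← sq_eq_sq₀ (norm_nonneg _) h0, Complex.sq_norm, Complex.normSq_apply]
  simp only [sub_re, sub_im, one_re, one_im, sin_re_eq, sin_im_eq]
  linear_combination (Real.sinh z.im ^ 2) * Real.sin_sq_add_cos_sq z.re
    + (Real.sin z.re ^ 2 - 1) * Real.cosh_sq z.im

theorem Complex.norm_sin_add_one (z : ℂ) :
    ‖sin z + 1‖ = Real.cosh z.im + Real.sin z.re := by
  have h := norm_sin_sub_one (-z)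
  rw [Complex.sin_neg, ← neg_add', norm_neg] at h
  simpa using h

/-- The sum of the distances from `sin z` to the foci `±1`. -/
theorem Complex.norm_sin_sub_one_add_norm_sin_add_one (z : ℂ) :
    ‖sin z - 1‖ + ‖sin z + 1‖ = 2 * Real.cosh z.im := by
  rw [norm_sin_sub_one, norm_sin_add_one]
  ring

theorem mem_omegaE_iff {ε : ℝ} (hε : 0 < ε) (w : ℂ) :
    w ∈ OmegaE ε ↔ ‖w - 1‖ + ‖w + 1‖ < 2 * Real.cosh ε := by
  constructor
  · rintro ⟨z, hz, rfl⟩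
    simp only [mem_ofPred_eq] at hz
    have him : ((ε : ℂ) * z).im = ε * z.im := by simp
    simp only [Complex.norm_sin_sub_one_add_norm_sin_add_one, him]
    refine mul_lt_mul_of_pos_left (Real.cosh_lt_cosh.2 ?_) two_pos
    rw [abs_mul, abs_of_pos hε]
    exact mul_lt_of_lt_one_right hε hz
  · intro h
    obtain ⟨ζ, rfl⟩ := Complex.sin_surjective w
    rw [Complex.norm_sin_sub_one_add_norm_sin_add_one] at h
    have hζ : |ζ.im| < ε := by
      have := Real.cosh_lt_cosh.1 (lt_of_mul_lt_mul_left h zero_le_two)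
      rwa [abs_of_pos hε] at this
    refine ⟨ζ / ε, ?_, ?_⟩
    · rw [mem_ofPred_eq, Complex.div_ofReal_im, abs_div, abs_of_pos hε]
      exact (div_lt_one hε).2 hζ
    · have : (ε : ℂ) ≠ 0 := by exact_mod_cast hε.ne'
      simp only [mul_div_cancel₀ ζ this]

theorem Real.one_add_sq_div_two_le_cosh (x : ℝ) : 1 + x ^ 2 / 2 ≤ Real.cosh x := by
  have h1 : (x / 2) ^ 2 ≤ Real.sinh (x / 2) ^ 2 := by
    rw [sq_le_sq, Real.abs_sinh]
    exact Real.self_le_sinh_iff.2 (abs_nonneg _)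
  have h2 := Real.cosh_two_mul (x / 2)
  rw [Real.cosh_sq, mul_div_cancel₀ x two_ne_zero] at h2
  linarith

theorem Real.cosh_half_add_sq_div_four_le_cosh (x : ℝ) :
    Real.cosh (x / 2) + x ^ 2 / 4 ≤ Real.cosh x := by
  have h1 : 1 + (x / 2) ^ 2 / 2 ≤ Real.cosh (x / 2) := Real.one_add_sq_div_two_le_cosh _
  have h2 := Real.cosh_two_mul (x / 2)
  rw [Real.sinh_sq, mul_div_cancel₀ x two_ne_zero] at h2
  nlinarith [sq_nonneg x, sq_nonneg (Real.cosh (x / 2) - 1)]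

/-- For `0 < ε ≤ 1`, any closed disk of radius `ε²/8` meeting `Ω_{ε/2}` is
contained in `Ω_ε`. -/
theorem closedBall_subset_omegaE (ε : ℝ) (hε0 : 0 < ε) (hε1 : ε ≤ 1) (c : ℂ)
    (h : (Metric.closedBall c (ε ^ 2 / 8) ∩ OmegaE (ε / 2)).Nonempty) :
    Metric.closedBall c (ε ^ 2 / 8) ⊆ OmegaE ε := by
  obtain ⟨w, hwc, hw⟩ := h
  intro z hz
  rw [mem_omegaE_iff (half_pos hε0)] at hw
  rw [mem_omegaE_iff hε0]
  have hzw : ‖z - w‖ ≤ ε ^ 2 / 4 := by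
    rw [Metric.mem_closedBall] at hz hwc
    rw [← dist_eq_norm]
    linarith [dist_triangle_right z w c]
  have h1 := norm_add_le (z - w) (w - 1)
  have h2 := norm_add_le (z - w) (w + 1)
  rw [sub_add_sub_cancel] at h1
  rw [← add_assoc, sub_add_cancel] at h2
  linarith [Real.cosh_half_add_sq_div_four_le_cosh ε]
end

section
/- Let m ≥ 1 be an integer, K ≥ 1 a real number, and r a real number with 0 < r ≤ 1. For all complex numbers g and h with |g| ≤ K and |h^m − g^{m+1}| ≤ r^{m+1}, one has | ḡ h | / (max(|g|, r))² ≤ (2K)^{1/m}, where ḡ denotes the complex conjugate of g. -/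
/-- Pointwise bound on the modified quotient: if `m ≥ 1`, `K ≥ 1`, `0 < r ≤ 1`,
`|g| ≤ K` and `|h^m − g^{m+1}| ≤ r^{m+1}`, then
`|ḡ h| / (max(|g|, r))² ≤ (2K)^{1/m}`. -/
theorem modified_quotient_bound (m : ℕ) (hm : 1 ≤ m) (K r : ℝ) (hK : 1 ≤ K)
    (hr0 : 0 < r) (hr1 : r ≤ 1) (g h : ℂ)
    (hg : ‖g‖ ≤ K) (hgh : ‖h ^ m - g ^ (m + 1)‖ ≤ r ^ (m + 1)) :
    ‖(starRingEnd ℂ) g * h‖ / (max ‖g‖ r) ^ 2 ≤ (2 * K) ^ ((1 : ℝ) / m) := by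
  have hgM : ‖g‖ ≤ max ‖g‖ r := le_max_left _ _
  have hrM : r ≤ max ‖g‖ r := le_max_right _ _
  have hMK : max ‖g‖ r ≤ K := max_le hg (hr1.trans hK)
  generalize max ‖g‖ r = M at *
  have hM : 0 < M := hr0.trans_le hrM
  have hpow : ‖h‖ ^ m ≤ 2 * K * M ^ m := by
    calc ‖h‖ ^ m = ‖(h ^ m - g ^ (m + 1)) + g ^ (m + 1)‖ := by
          rw [sub_add_cancel, norm_pow]
      _ ≤ r ^ (m + 1) + ‖g‖ ^ (m + 1) :=
          (norm_add_le _ _).trans (add_le_add hgh (norm_pow g (m + 1)).le)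
      _ ≤ M ^ (m + 1) + M ^ (m + 1) := by gcongr
      _ = 2 * M * M ^ m := by ring
      _ ≤ 2 * K * M ^ m := by gcongr
  have hquot : (‖h‖ / M) ^ m ≤ 2 * K := by
    rwa [div_pow, div_le_iff₀ (pow_pos hM m)]
  calc ‖(starRingEnd ℂ) g * h‖ / M ^ 2 = ‖g‖ * ‖h‖ / M ^ 2 := by
        rw [norm_mul, RCLike.norm_conj]
    _ ≤ M * ‖h‖ / M ^ 2 := by gcongr
    _ = ‖h‖ / M := by field_simp
    _ = ((‖h‖ / M) ^ m) ^ ((1 : ℝ) / m) := by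
        rw [one_div, Real.pow_rpow_inv_natCast (by positivity) (by omega)]
    _ ≤ (2 * K) ^ ((1 : ℝ) / m) := by gcongr
end

section
/- Let m ≥ 1 be an integer and K ≥ 1 a real number. Set c₆ = 2^{1+1/m} + (K+1)^{1/m} + 1. For every real number δ with 0 < δ ≤ 1, setting r = δ^{1/(m+1)}, and for all complex numbers f, g, h satisfying |f^{m+1} − h| ≤ δ, |f^m − g| ≤ δ, |h^m − g^{m+1}| ≤ δ, and |g| ≤ K, one has | f − ḡ h / (max(|g|, r))² | ≤ c₆ δ^{1/(m(m+1))}, where ḡ denotes the complex conjugate of g. -/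
/-- The modified quotient estimate away from the zeros of `g`, where it is `h / g`. -/
theorem norm_sub_quotient_le_of_le_norm {m : ℕ} (hm : 1 ≤ m) {s B : ℝ} (hs0 : 0 < s)
    (hs1 : s ≤ 1) (hB : 0 ≤ B) {f g h : ℂ} (hfh : ‖f ^ (m + 1) - h‖ ≤ s ^ (m * (m + 1)))
    (hfg : ‖f ^ m - g‖ ≤ s ^ (m * (m + 1))) (hfB : ‖f‖ ≤ B) (hg : s ^ m ≤ ‖g‖) :
    ‖f - (starRingEnd ℂ) g * h / ((‖g‖ ^ 2 : ℝ) : ℂ)‖ ≤ (B + 1) * s := by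
  have hg0 : 0 < ‖g‖ := (pow_pos hs0 m).trans_le hg
  have hgne : g ≠ 0 := norm_pos_iff.mp hg0
  have hquot : (starRingEnd ℂ) g * h / ((‖g‖ ^ 2 : ℝ) : ℂ) = h / g := by
    have hconj : (starRingEnd ℂ) g ≠ 0 := by simpa using hgne
    rw [Complex.ofReal_pow, ← Complex.conj_mul', mul_div_mul_left _ _ hconj]
  have hnum : ‖f * g - h‖ ≤ (B + 1) * s ^ (m * (m + 1)) := by
    have hsplit : f * g - h = (f ^ (m + 1) - h) - f * (f ^ m - g) := by ring
    calc ‖f * g - h‖ ≤ ‖f ^ (m + 1) - h‖ + ‖f‖ * ‖f ^ m - g‖ := by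
          rw [hsplit, ← norm_mul]
          exact norm_sub_le _ _
      _ ≤ s ^ (m * (m + 1)) + B * s ^ (m * (m + 1)) := by gcongr
      _ = (B + 1) * s ^ (m * (m + 1)) := by ring
  have hpow : s ^ (m * (m + 1)) ≤ s * ‖g‖ :=
    calc s ^ (m * (m + 1)) ≤ s ^ (m + 1) :=
          pow_le_pow_of_le_one hs0.le hs1 (Nat.le_mul_of_pos_left _ hm)
      _ = s * s ^ m := pow_succ' s m
      _ ≤ s * ‖g‖ := by gcongr
  rw [hquot, show f - h / g = (f * g - h) / g by field_simp, norm_div, div_le_iff₀ hg0]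
  calc ‖f * g - h‖ ≤ (B + 1) * s ^ (m * (m + 1)) := hnum
    _ ≤ (B + 1) * (s * ‖g‖) := by gcongr
    _ = (B + 1) * s * ‖g‖ := by ring

/-- The modified quotient estimate near the zeros of `g`, where both terms are small. -/
theorem norm_sub_quotient_le_of_norm_le {m : ℕ} (hm : 1 ≤ m) {s A : ℝ} (hs0 : 0 < s)
    (hs1 : s ≤ 1) (hA : 0 ≤ A) (hAm : A ^ m = 2) {f g h : ℂ}
    (hfg : ‖f ^ m - g‖ ≤ s ^ (m * (m + 1)))
    (hgh : ‖h ^ m - g ^ (m + 1)‖ ≤ s ^ (m * (m + 1))) (hg : ‖g‖ ≤ s ^ m) :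
    ‖f - (starRingEnd ℂ) g * h / (((s ^ m) ^ 2 : ℝ) : ℂ)‖ ≤ 2 * A * s := by
  have hm0 : m ≠ 0 := Nat.one_le_iff_ne_zero.mp hm
  have hr : 0 < s ^ m := pow_pos hs0 m
  have hf : ‖f‖ ≤ A * s := by
    refine le_of_pow_le_pow_left₀ hm0 (by positivity) ?_
    calc ‖f‖ ^ m = ‖f ^ m‖ := (norm_pow f m).symm
      _ ≤ ‖f ^ m - g‖ + ‖g‖ := norm_le_norm_sub_add _ _
      _ ≤ s ^ m + s ^ m := add_le_add
          (hfg.trans (pow_le_pow_of_le_one hs0.le hs1 (Nat.le_mul_of_pos_right _ m.succ_pos))) hg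
      _ = (A * s) ^ m := by rw [mul_pow, hAm]; ring
  have hh : ‖h‖ ≤ A * s ^ (m + 1) := by
    refine le_of_pow_le_pow_left₀ hm0 (by positivity) ?_
    calc ‖h‖ ^ m = ‖h ^ m‖ := (norm_pow h m).symm
      _ ≤ ‖h ^ m - g ^ (m + 1)‖ + ‖g ^ (m + 1)‖ := norm_le_norm_sub_add _ _
      _ ≤ s ^ (m * (m + 1)) + (s ^ m) ^ (m + 1) := by
          rw [norm_pow g]
          gcongr
      _ = (A * s ^ (m + 1)) ^ m := by rw [mul_pow, hAm, ← pow_mul, ← pow_mul]; ring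
  have hquot : ‖(starRingEnd ℂ) g * h / (((s ^ m) ^ 2 : ℝ) : ℂ)‖ ≤ A * s := by
    rw [norm_div, norm_mul, RCLike.norm_conj, Complex.norm_real,
      Real.norm_of_nonneg (by positivity), div_le_iff₀ (by positivity)]
    calc ‖g‖ * ‖h‖ ≤ s ^ m * (A * s ^ (m + 1)) := by gcongr
      _ = A * s * (s ^ m) ^ 2 := by ring
  calc _ ≤ ‖f‖ + ‖(starRingEnd ℂ) g * h / (((s ^ m) ^ 2 : ℝ) : ℂ)‖ := norm_sub_le _ _
    _ ≤ A * s + A * s := add_le_add hf hquot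
    _ = 2 * A * s := by ring


/-- Pointwise approximation of `f` by the modified quotient: with
`c₆ = 2^{1+1/m} + (K+1)^{1/m} + 1` and `r = δ^{1/(m+1)}`, the hypotheses
`|f^{m+1} − h| ≤ δ`, `|f^m − g| ≤ δ`, `|h^m − g^{m+1}| ≤ δ` and `|g| ≤ K` imply
`|f − ḡ h / (max(|g|, r))²| ≤ c₆ δ^{1/(m(m+1))}`. -/
theorem modified_quotient_approx (m : ℕ) (hm : 1 ≤ m) (K : ℝ) (hK : 1 ≤ K)
    (δ : ℝ) (hδ0 : 0 < δ) (hδ1 : δ ≤ 1) (f g h : ℂ)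
    (hfh : ‖f ^ (m + 1) - h‖ ≤ δ) (hfg : ‖f ^ m - g‖ ≤ δ)
    (hgh : ‖h ^ m - g ^ (m + 1)‖ ≤ δ) (hg : ‖g‖ ≤ K) :
    ‖f - (starRingEnd ℂ) g * h / (((max ‖g‖ (δ ^ ((1 : ℝ) / (m + 1)))) ^ 2 : ℝ) : ℂ)‖ ≤
      (2 ^ (1 + (1 : ℝ) / m) + (K + 1) ^ ((1 : ℝ) / m) + 1) *
        δ ^ ((1 : ℝ) / (m * (m + 1))) := by
  have hm0 : m ≠ 0 := Nat.one_le_iff_ne_zero.mp hm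
  have hmR : (m : ℝ) ≠ 0 := Nat.cast_ne_zero.mpr hm0
  have hm1R : (m : ℝ) + 1 ≠ 0 := by positivity
  set s : ℝ := δ ^ ((1 : ℝ) / (m * (m + 1)))
  set A : ℝ := 2 ^ ((1 : ℝ) / m)
  set B : ℝ := (K + 1) ^ ((1 : ℝ) / m)
  have hs0 : 0 < s := Real.rpow_pos_of_pos hδ0 _
  have hs1 : s ≤ 1 := Real.rpow_le_one hδ0.le hδ1 (by positivity)
  have hA : 0 ≤ A := by positivity
  have hB : 0 ≤ B := by positivity
  have hAm : A ^ m = 2 := by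
    rw [← Real.rpow_mul_natCast zero_le_two, one_div_mul_cancel hmR, Real.rpow_one]
  have hBm : B ^ m = K + 1 := by
    rw [← Real.rpow_mul_natCast (by positivity), one_div_mul_cancel hmR, Real.rpow_one]
  have hA2 : (2 : ℝ) ^ (1 + (1 : ℝ) / m) = 2 * A := by
    rw [Real.rpow_add two_pos, Real.rpow_one]
  have hr : δ ^ ((1 : ℝ) / (m + 1)) = s ^ m := by
    rw [← Real.rpow_mul_natCast hδ0.le]
    congr 1
    field_simp
  have hδ : δ = s ^ (m * (m + 1)) := by
    rw [pow_mul, ← hr, ← Real.rpow_mul_natCast hδ0.le, Nat.cast_add_one,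
      one_div_mul_cancel hm1R, Real.rpow_one]
  have hfB : ‖f‖ ≤ B := by
    refine le_of_pow_le_pow_left₀ hm0 hB ?_
    rw [hBm, ← norm_pow]
    linarith [norm_le_norm_sub_add (f ^ m) g]
  rw [hA2, hr]
  rw [hδ] at hfh hfg hgh
  rcases le_total (s ^ m) ‖g‖ with hle | hle
  · rw [max_eq_left hle]
    calc _ ≤ (B + 1) * s := norm_sub_quotient_le_of_le_norm hm hs0 hs1 hB hfh hfg hfB hle
      _ ≤ (2 * A + B + 1) * s := by gcongr; linarith
  · rw [max_eq_right hle]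
    calc _ ≤ 2 * A * s := norm_sub_quotient_le_of_norm_le hm hs0 hs1 hA hAm hfg hgh hle
      _ ≤ (2 * A + B + 1) * s := by gcongr; linarith
end

section
/- Let M be a weight sequence satisfying the moderate growth condition. Then there exists a constant κ ≥ 1 such that t^{−j} h_M(t) ≤ κ^j M_j h_M(κ t) for every real number t > 0 and every j ∈ ℕ. -/
open Set Filter MeasureTheory Topology

/-- If `M` has moderate growth, there is `κ ≥ 1` with
`t⁻ʲ h_M(t) ≤ κʲ M_j h_M(κ t)` for all `t > 0` and `j ∈ ℕ`. -/
theorem hFun_div_pow_le (M : ℕ → ℝ) (hM : IsWeightSeq M) (hMG : ModerateGrowth M) :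
    ∃ κ : ℝ, 1 ≤ κ ∧ ∀ t : ℝ, 0 < t → ∀ j : ℕ,
      hFun M t / t ^ j ≤ κ ^ j * M j * hFun M (κ * t) := by
  obtain ⟨hpos, -⟩ := hM
  obtain ⟨A, hA, hAM⟩ := hMG
  refine ⟨max 1 A, le_max_left _ _, fun t ht j => ?_⟩
  set κ := max 1 A
  have hκ : 0 < κ := lt_max_of_lt_left one_pos
  have hC : 0 < κ ^ j * M j := mul_pos (pow_pos hκ j) (hpos j)
  have hbdd : BddBelow (range fun i : ℕ => t ^ i * M i) :=
    ⟨0, by rintro _ ⟨i, rfl⟩; exact (mul_pos (pow_pos ht i) (hpos i)).le⟩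
  rw [hFun, hFun, if_neg ht.ne', if_neg (mul_pos hκ ht).ne', ← div_le_iff₀' hC]
  refine le_ciInf fun k => ?_
  rw [div_le_iff₀' hC, div_le_iff₀ (pow_pos ht j)]
  calc ⨅ i : ℕ, t ^ i * M i ≤ t ^ (j + k) * M (j + k) := ciInf_le hbdd (j + k)
    _ ≤ t ^ (j + k) * (κ ^ (j + k) * (M j * M k)) := by
        have hMjk := mul_pos (hpos j) (hpos k)
        gcongr
        refine (hAM j k).trans ?_
        gcongr
        exact le_max_right _ _
    _ = κ ^ j * M j * ((κ * t) ^ k * M k) * t ^ j := by ring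
end
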